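/- Let A, B ∈ ℝ^{n×n} be such that the pair (A,B) is controllable, i.e., the n×n² controllability matrix [B, AB, A²B, …, A^{n−1}B] has rank n, and such that every eigenvalue of A lies on the imaginary axis. Then for every γ > 0 the parametric algebraic Riccati equation AᵀP + PA − P·B·Bᵀ·P = −γP has a unique symmetric positive definite solution P = P(γ). -/

import Mathlib

open Matrix

open Filter Topology

/-- In a complex Banach algebra, the powers of an element whose spectrum lies in the open unit
disc tend to zero. -/
theorem tendsto_pow_zero_of_spectrum_norm_lt_one {R : Type*} [NormedRing R] [NormedAlgebra ℂ R]
    [CompleteSpace R] [Nontrivial R] {a : R} (h : ∀ z ∈ spectrum ℂ a, ‖z‖ < 1) :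
    Tendsto (fun k : ℕ => a ^ k) atTop (𝓝 0) := by
  have hr : spectralRadius ℂ a < ((1 : NNReal) : ENNReal) :=
    spectrum.spectralRadius_lt_of_forall_lt a fun z hz => by exact_mod_cast h z hz
  obtain ⟨q, hq, hq1⟩ := ENNReal.lt_iff_exists_nnreal_btwn.1 hr
  have hq1 : q < 1 := by exact_mod_cast hq1
  have hev := (spectrum.pow_nnnorm_pow_one_div_tendsto_nhds_spectralRadius a).eventually_lt_const hq
  refine squeeze_zero_norm' (a := fun k : ℕ => (q : ℝ) ^ k) ?_
    (tendsto_pow_atTop_nhds_zero_of_lt_one q.2 hq1)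
  filter_upwards [hev, eventually_gt_atTop 0] with k hk hk0
  have hk' : (0 : ℝ) < k := by exact_mod_cast hk0
  rw [one_div, ENNReal.rpow_inv_lt_iff hk', ENNReal.rpow_natCast] at hk
  exact_mod_cast hk.le

section Lyapunov

variable {n : Type*} [Fintype n] [DecidableEq n] {F : Matrix n n ℝ}

/-- The spectrum of a matrix over a field consists of its eigenvalues. -/
theorem Matrix.mem_spectrum_iff_exists_mulVec_eq_smul {K : Type*} [Field K] {M : Matrix n n K}
    {μ : K} : μ ∈ spectrum K M ↔ ∃ v ≠ 0, M *ᵥ v = μ • v := by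
  rw [spectrum.mem_iff, Matrix.isUnit_iff_isUnit_det, isUnit_iff_ne_zero, not_not,
    ← Matrix.exists_mulVec_eq_zero_iff]
  refine exists_congr fun v => and_congr_right fun _ => ?_
  rw [Matrix.sub_mulVec, sub_eq_zero, Algebra.algebraMap_eq_smul_one, Matrix.smul_mulVec,
    Matrix.one_mulVec, eq_comm]

/-- The powers of a complex matrix whose eigenvalues lie in the open unit disc tend to zero. -/
theorem Matrix.tendsto_pow_zero_of_spectrum_norm_lt_one {M : Matrix n n ℂ}
    (h : ∀ z ∈ spectrum ℂ M, ‖z‖ < 1) : Tendsto (fun k : ℕ => M ^ k) atTop (𝓝 0) := by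
  rcases isEmpty_or_nonempty n with hn | hn
  · exact tendsto_const_nhds.congr fun k => Subsingleton.elim _ _
  · let := Matrix.linftyOpNormedRing (n := n) (α := ℂ)
    let := Matrix.linftyOpNormedAlgebra (n := n) (R := ℂ) (α := ℂ)
    have : CompleteSpace (Matrix n n ℂ) := FiniteDimensional.complete ℂ _
    exact _root_.tendsto_pow_zero_of_spectrum_norm_lt_one h

/-- A real matrix with spectrum in the open right half plane does not have eigenvalue `-1`. -/
theorem isUnit_det_add_one_of_spectrum_re_pos
    (hF : ∀ μ ∈ spectrum ℂ (F.map Complex.ofReal), 0 < μ.re) :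
    IsUnit (F + 1).det := by
  rw [isUnit_iff_ne_zero, Ne, ← Matrix.exists_mulVec_eq_zero_iff]
  rintro ⟨v, hv, h⟩
  rw [Matrix.add_mulVec, Matrix.one_mulVec, add_eq_zero_iff_eq_neg] at h
  have hmem : (-1 : ℂ) ∈ spectrum ℂ (F.map Complex.ofReal) := by
    refine Matrix.mem_spectrum_iff_exists_mulVec_eq_smul.2 ⟨fun i => (v i : ℂ), fun h0 => hv ?_, ?_⟩
    · ext i
      exact Complex.ofReal_eq_zero.1 (congrFun h0 i)
    · ext i
      have := RingHom.map_mulVec Complex.ofRealHom F v i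
      rw [h] at this
      simpa using! this.symm
  have := hF _ hmem
  norm_num at this

/-- The Cayley transform of a matrix with spectrum in the open right half plane has powers
tending to zero. -/
theorem tendsto_cayley_pow_zero (hF : ∀ μ ∈ spectrum ℂ (F.map Complex.ofReal), 0 < μ.re) :
    Tendsto (fun k : ℕ => ((F + 1)⁻¹ * (F - 1)) ^ k) atTop (𝓝 0) := by
  set C := (F + 1)⁻¹ * (F - 1)
  have hCF : (F + 1) * C = F - 1 :=
    Matrix.mul_nonsing_inv_cancel_left _ _ (isUnit_det_add_one_of_spectrum_re_pos hF)
  have hlim : Tendsto (fun k : ℕ => (C.map Complex.ofReal) ^ k) atTop (𝓝 0) := by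
    refine Matrix.tendsto_pow_zero_of_spectrum_norm_lt_one fun z hz => ?_
    obtain ⟨v, hv, hzv⟩ := Matrix.mem_spectrum_iff_exists_mulVec_eq_smul.1 hz
    have hCF' : (F.map Complex.ofReal + 1) * C.map Complex.ofReal = F.map Complex.ofReal - 1 := by
      have := congrArg Complex.ofRealHom.mapMatrix hCF
      rwa [map_mul, map_add, map_sub, map_one] at this
    set w := F.map Complex.ofReal *ᵥ v
    have hv' : z • (w + v) = w - v := by
      have := congrArg (· *ᵥ v) hCF'
      simpa only [← Matrix.mulVec_mulVec, hzv, Matrix.mulVec_smul, Matrix.add_mulVec,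
        Matrix.sub_mulVec, Matrix.one_mulVec] using this
    have hz1 : 1 - z ≠ 0 := by
      intro h1
      obtain rfl : 1 = z := sub_eq_zero.1 h1
      refine hv (self_eq_neg.1 (add_left_cancel (a := w) ?_))
      rwa [one_smul, sub_eq_add_neg] at hv'
    have hμ : w = ((1 + z) / (1 - z)) • v := by
      have : (1 - z) • w = (1 + z) • v := by
        rw [smul_add, ← sub_eq_zero] at hv'
        rw [sub_smul, add_smul, one_smul, one_smul, ← sub_eq_zero, ← neg_eq_zero, ← hv']
        abel
      rw [div_eq_inv_mul, mul_smul, ← this, inv_smul_smul₀ hz1]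
    have hpos := hF _ (Matrix.mem_spectrum_iff_exists_mulVec_eq_smul.2 ⟨v, hv, hμ⟩)
    set μ := (1 + z) / (1 - z)
    have hmul : (1 - z) * μ = 1 + z := mul_div_cancel₀ _ hz1
    have h1 := congrArg Complex.re hmul
    have h2 := congrArg Complex.im hmul
    have h3 := Complex.normSq_pos.2 hz1
    simp only [Complex.mul_re, Complex.mul_im, Complex.sub_re, Complex.sub_im, Complex.add_re,
      Complex.add_im, Complex.one_re, Complex.one_im, Complex.normSq_apply] at h1 h2 h3
    rw [← sq_lt_one_iff₀ (norm_nonneg z), ← Complex.normSq_eq_norm_sq, Complex.normSq_apply]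
    linear_combination mul_pos hpos h3 + (1 - z.re) * h1 - z.im * h2
  have hre : Continuous fun M : Matrix n n ℂ => M.map Complex.re :=
    continuous_id.matrix_map Complex.continuous_re
  have h0 : (0 : Matrix n n ℂ).map Complex.re = 0 := Matrix.map_zero _ Complex.zero_re
  refine h0 ▸ ((hre.tendsto 0).comp hlim).congr fun k => ?_
  have hk : (C.map Complex.ofReal) ^ k = (C ^ k).map Complex.ofReal :=
    (map_pow Complex.ofRealHom.mapMatrix C k).symm
  ext i j
  simp [hk]

theorem Matrix.eq_conj_pow_of_eq_conj {C W : Matrix n n ℝ} (h : W = C * W * Cᵀ) (k : ℕ) :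
    W = C ^ k * W * (C ^ k)ᵀ := by
  induction k with
  | zero => simp
  | succ k ih =>
    nth_rewrite 1 [ih]
    nth_rewrite 1 [h]
    simp only [pow_succ, Matrix.transpose_mul, Matrix.mul_assoc]

theorem tendsto_conj_pow_zero {C : Matrix n n ℝ} (hC : Tendsto (fun k : ℕ => C ^ k) atTop (𝓝 0))
    (W : Matrix n n ℝ) : Tendsto (fun k : ℕ => C ^ k * W * (C ^ k)ᵀ) atTop (𝓝 0) := by
  have hcont : Continuous fun M : Matrix n n ℝ => M * W * Mᵀ := by fun_prop
  have hlim := (hcont.tendsto 0).comp hC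
  rwa [Matrix.zero_mul, Matrix.zero_mul] at hlim

/-- Solutions of the Stein inequality for a stable matrix are positive semidefinite. -/
theorem posSemidef_of_stein {C W : Matrix n n ℝ}
    (hC : Tendsto (fun k : ℕ => C ^ k) atTop (𝓝 0)) (hW : W.IsHermitian)
    (h : (W - C * W * Cᵀ).PosSemidef) : W.PosSemidef := by
  have key (k : ℕ) : (W - C ^ k * W * (C ^ k)ᵀ).PosSemidef := by
    induction k with
    | zero => simpa using Matrix.PosSemidef.zero
    | succ k ih =>
      have := (h.mul_mul_conjTranspose_same (C ^ k)).add ih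
      simpa [Matrix.mul_sub, Matrix.sub_mul, pow_succ, Matrix.mul_assoc] using this
  refine .of_dotProduct_mulVec_nonneg hW fun x => ?_
  have hcont : Continuous fun M : Matrix n n ℝ => star x ⬝ᵥ ((W - M) *ᵥ x) := by fun_prop
  have hlim := (hcont.tendsto 0).comp (tendsto_conj_pow_zero hC W)
  rw [sub_zero] at hlim
  exact ge_of_tendsto' hlim fun k => (key k).dotProduct_mulVec_nonneg x

theorem sub_cayley_conj (hF : ∀ μ ∈ spectrum ℂ (F.map Complex.ofReal), 0 < μ.re)
    (W : Matrix n n ℝ) :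
    W - ((F + 1)⁻¹ * (F - 1)) * W * ((F + 1)⁻¹ * (F - 1))ᵀ =
      (F + 1)⁻¹ * ((2 : ℝ) • (F * W + W * Fᵀ)) * ((F + 1)⁻¹)ᵀ := by
  have hu := isUnit_det_add_one_of_spectrum_re_pos hF
  have h : (F + 1) * W * (F + 1)ᵀ - (F - 1) * W * (F - 1)ᵀ = (2 : ℝ) • (F * W + W * Fᵀ) := by
    rw [two_smul]
    simp only [Matrix.transpose_add, Matrix.transpose_sub, Matrix.transpose_one]
    noncomm_ring
  have hl : (F + 1)⁻¹ * (F + 1) = 1 := Matrix.nonsing_inv_mul _ hu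
  have hr : (F + 1)ᵀ * ((F + 1)⁻¹)ᵀ = 1 := by rw [← Matrix.transpose_mul, hl, Matrix.transpose_one]
  calc _ = ((F + 1)⁻¹ * (F + 1)) * W * ((F + 1)ᵀ * ((F + 1)⁻¹)ᵀ) -
        ((F + 1)⁻¹ * (F - 1)) * W * ((F + 1)⁻¹ * (F - 1))ᵀ := by rw [hl, hr]; simp
    _ = _ := by
      rw [← h, Matrix.mul_sub _ ((F + 1) * W * (F + 1)ᵀ),
        Matrix.sub_mul _ _ ((F + 1)⁻¹)ᵀ]
      simp only [Matrix.transpose_mul, Matrix.mul_assoc]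

theorem eq_zero_of_lyapunov_eq_zero
    (hF : ∀ μ ∈ spectrum ℂ (F.map Complex.ofReal), 0 < μ.re) {W : Matrix n n ℝ}
    (h : F * W + W * Fᵀ = 0) : W = 0 := by
  have hs := sub_cayley_conj hF W
  rw [h, smul_zero, Matrix.mul_zero, Matrix.zero_mul, sub_eq_zero] at hs
  exact tendsto_nhds_unique (tendsto_const_nhds.congr (Matrix.eq_conj_pow_of_eq_conj hs))
    (tendsto_conj_pow_zero (tendsto_cayley_pow_zero hF) W)

theorem lyapunov_unique (hF : ∀ μ ∈ spectrum ℂ (F.map Complex.ofReal), 0 < μ.re)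
    {W V : Matrix n n ℝ} (h : F * W + W * Fᵀ = F * V + V * Fᵀ) : W = V := by
  refine sub_eq_zero.1 (eq_zero_of_lyapunov_eq_zero hF ?_)
  rw [Matrix.mul_sub, Matrix.sub_mul, sub_add_sub_comm, h, sub_self]

theorem exists_lyapunov (hF : ∀ μ ∈ spectrum ℂ (F.map Complex.ofReal), 0 < μ.re)
    (Q : Matrix n n ℝ) : ∃ W, F * W + W * Fᵀ = Q := by
  let L : Matrix n n ℝ →ₗ[ℝ] Matrix n n ℝ := LinearMap.mulLeft ℝ F + LinearMap.mulRight ℝ Fᵀ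
  have hL : Function.Injective L := fun W V h => lyapunov_unique hF h
  exact LinearMap.injective_iff_surjective.1 hL Q

theorem posSemidef_of_lyapunov (hF : ∀ μ ∈ spectrum ℂ (F.map Complex.ofReal), 0 < μ.re)
    {W Q : Matrix n n ℝ} (hQ : Q.PosSemidef)
    (h : F * W + W * Fᵀ = Q) : W.PosSemidef := by
  have hW : W.IsHermitian := by
    refine lyapunov_unique hF ?_
    have := congrArg Matrix.transpose h
    rw [Matrix.transpose_add, Matrix.transpose_mul, Matrix.transpose_mul,
      Matrix.transpose_transpose, add_comm] at this
    rw [Matrix.conjTranspose_eq_transpose_of_trivial, this, h]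
    exact hQ.isHermitian
  refine posSemidef_of_stein (tendsto_cayley_pow_zero hF) hW ?_
  rw [sub_cayley_conj hF, h]
  exact (hQ.smul zero_le_two).mul_mul_conjTranspose_same _

/-- If `(A, B)` is controllable, a left vector annihilating every `A ^ k * B` vanishes. -/
theorem eq_zero_of_vecMul_pow_mul_eq_zero {n : ℕ} {A B : Matrix (Fin n) (Fin n) ℝ}
    (hctrb : (Matrix.of fun (i : Fin n) (jk : Fin n × Fin n) =>
      (A ^ (jk.1 : ℕ) * B) i jk.2).rank = n)
    {x : Fin n → ℝ} (hx : ∀ k : ℕ, x ᵥ* (A ^ k * B) = 0) : x = 0 := by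
  rw [Matrix.rank_eq_finrank_span_row] at hctrb
  have hli := linearIndependent_iff_card_eq_finrank_span.2
    ((Fintype.card_fin n).trans hctrb.symm)
  refine Matrix.vecMul_injective_iff.2 hli ?_
  ext jk
  simpa [Matrix.vecMul, dotProduct] using congrFun (hx jk.1) jk.2

theorem posDef_of_lyapunov_of_controllable {n : ℕ} {A B W : Matrix (Fin n) (Fin n) ℝ} {c : ℝ}
    (hctrb : (Matrix.of fun (i : Fin n) (jk : Fin n × Fin n) =>
      (A ^ (jk.1 : ℕ) * B) i jk.2).rank = n)
    (hW : W.PosSemidef) (h : A * W + W * Aᵀ + c • W = B * Bᵀ) : W.PosDef := by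
  refine .of_dotProduct_mulVec_pos hW.isHermitian fun x hx => ?_
  refine (hW.dotProduct_mulVec_nonneg x).lt_of_ne' fun h0 => hx ?_
  have hsymm : Wᵀ = W := hW.isHermitian
  have step (y : Fin n → ℝ) (hy : W *ᵥ y = 0) : Bᵀ *ᵥ y = 0 ∧ W *ᵥ (Aᵀ *ᵥ y) = 0 := by
    have hy' : y ᵥ* W = 0 := by rw [← hsymm, Matrix.vecMul_transpose, hy]
    have hmul := congrArg (· *ᵥ y) h
    simp only [Matrix.add_mulVec, ← Matrix.mulVec_mulVec, Matrix.smul_mulVec, hy,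
      Matrix.mulVec_zero, smul_zero, zero_add, add_zero] at hmul
    have hB : Bᵀ *ᵥ y = 0 := by
      rw [← dotProduct_self_eq_zero, ← Matrix.vecMul_transpose, Matrix.transpose_transpose,
        ← Matrix.dotProduct_mulVec, ← Matrix.mulVec_transpose, ← hmul,
        Matrix.dotProduct_mulVec, hy', zero_dotProduct]
    exact ⟨hB, by rw [hmul, hB, Matrix.mulVec_zero]⟩
  have hker (k : ℕ) : W *ᵥ ((A ^ k)ᵀ *ᵥ x) = 0 := by
    induction k with
    | zero => simpa using (hW.dotProduct_mulVec_zero_iff x).1 h0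
    | succ k ih =>
      rw [pow_succ, Matrix.transpose_mul, ← Matrix.mulVec_mulVec]
      exact (step _ ih).2
  refine eq_zero_of_vecMul_pow_mul_eq_zero hctrb fun k => ?_
  rw [← Matrix.mulVec_transpose, Matrix.transpose_mul, ← Matrix.mulVec_mulVec]
  exact (step _ (hker k)).1

/-- An invertible matrix solves the parametric Riccati equation iff its inverse solves the
associated Lyapunov equation. -/
theorem riccati_iff_lyapunov_inv {A B P : Matrix n n ℝ} {γ : ℝ} (hP : IsUnit P.det) :
    Aᵀ * P + P * A - P * B * Bᵀ * P = -γ • P ↔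
      A * P⁻¹ + P⁻¹ * Aᵀ + γ • P⁻¹ = B * Bᵀ := by
  have h1 : P⁻¹ * P = 1 := Matrix.nonsing_inv_mul _ hP
  have h2 : P * P⁻¹ = 1 := Matrix.mul_nonsing_inv _ hP
  have key : P * (A * P⁻¹ + P⁻¹ * Aᵀ + γ • P⁻¹ - B * Bᵀ) * P =
      Aᵀ * P + P * A - P * B * Bᵀ * P + γ • P := by
    have e1 : P * (A * P⁻¹) * P = P * A := by simp only [Matrix.mul_assoc, h1, Matrix.mul_one]
    have e2 : P * (P⁻¹ * Aᵀ) * P = Aᵀ * P := by rw [← Matrix.mul_assoc, h2, Matrix.one_mul]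
    simp only [Matrix.mul_sub, Matrix.mul_add, Matrix.sub_mul, Matrix.add_mul, e1, e2,
      Matrix.mul_smul, Matrix.smul_mul, h2, Matrix.one_mul, Matrix.mul_assoc]
    abel
  rw [neg_smul, ← sub_eq_zero, sub_neg_eq_add, ← key, ← sub_eq_zero (b := B * Bᵀ)]
  refine ⟨fun h => ?_, fun h => by rw [h, Matrix.mul_zero, Matrix.zero_mul]⟩
  have hu := (Matrix.isUnit_iff_isUnit_det P).2 hP
  rwa [hu.mul_left_eq_zero, hu.mul_right_eq_zero] at h

end Lyapunov

/-- If `(A,B)` is controllable and all eigenvalues of `A` lie on the imaginary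
axis, then for every `γ > 0` the parametric ARE `AᵀP + PA - PBBᵀP = -γP` has a
unique symmetric positive definite solution. -/
theorem stmt15 {n : ℕ}
    (A B : Matrix (Fin n) (Fin n) ℝ)
    (hctrb : (Matrix.of fun (i : Fin n) (jk : Fin n × Fin n) =>
      (A ^ (jk.1 : ℕ) * B) i jk.2).rank = n)
    (him : ∀ μ ∈ spectrum ℂ (A.map Complex.ofReal), μ.re = 0) :
    ∀ γ : ℝ, 0 < γ →
      ∃! P : Matrix (Fin n) (Fin n) ℝ,
        P.PosDef ∧ Aᵀ * P + P * A - P * B * Bᵀ * P = -γ • P := by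
  intro γ hγ
  set F : Matrix (Fin n) (Fin n) ℝ := A + (γ / 2) • 1 with hFdef
  have hF : ∀ μ ∈ spectrum ℂ (F.map Complex.ofReal), 0 < μ.re := by
    intro μ hμ
    obtain ⟨v, hv, hμv⟩ := Matrix.mem_spectrum_iff_exists_mulVec_eq_smul.1 hμ
    have hmap : F.map Complex.ofReal = A.map Complex.ofReal + ((γ / 2 : ℝ) : ℂ) • 1 := by
      ext i j
      simp [hFdef, Matrix.one_apply, apply_ite Complex.ofReal]
    have hmem : μ - ((γ / 2 : ℝ) : ℂ) ∈ spectrum ℂ (A.map Complex.ofReal) := by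
      refine Matrix.mem_spectrum_iff_exists_mulVec_eq_smul.2 ⟨v, hv, ?_⟩
      rw [hmap, Matrix.add_mulVec, Matrix.smul_mulVec, Matrix.one_mulVec] at hμv
      rw [sub_smul, ← hμv, add_sub_cancel_right]
    have := him _ hmem
    rw [Complex.sub_re, Complex.ofReal_re] at this
    linarith
  have hlyap (W : Matrix (Fin n) (Fin n) ℝ) :
      F * W + W * Fᵀ = A * W + W * Aᵀ + γ • W := by
    have hhalf : γ • W = (γ / 2) • W + (γ / 2) • W := by rw [← add_smul, add_halves]
    simp only [hFdef, Matrix.transpose_add, Matrix.transpose_smul, Matrix.transpose_one,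
      Matrix.add_mul, Matrix.mul_add, Matrix.smul_mul, Matrix.mul_smul, Matrix.one_mul,
      Matrix.mul_one, hhalf]
    abel
  obtain ⟨W, hW⟩ := exists_lyapunov hF (B * Bᵀ)
  have hWpd : W.PosDef := posDef_of_lyapunov_of_controllable hctrb
    (posSemidef_of_lyapunov hF (Matrix.posSemidef_self_mul_conjTranspose B) hW)
    ((hlyap W).symm.trans hW)
  have hdet {P : Matrix (Fin n) (Fin n) ℝ} (hP : P.PosDef) : IsUnit P.det :=
    (Matrix.isUnit_iff_isUnit_det P).1 hP.isUnit
  refine ⟨W⁻¹, ⟨hWpd.inv, ?_⟩, ?_⟩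
  · rw [riccati_iff_lyapunov_inv (hdet hWpd.inv), Matrix.nonsing_inv_nonsing_inv _ (hdet hWpd),
      ← hlyap, hW]
  · rintro P ⟨hP, h⟩
    rw [riccati_iff_lyapunov_inv (hdet hP), ← hlyap] at h
    rw [← lyapunov_unique hF (h.trans hW.symm), Matrix.nonsing_inv_nonsing_inv _ (hdet hP)]
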